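/- arXiv:2409.14480 — 2 statements merged into one kernel-verified Lean document; each statement's English description precedes it below -/
import Mathlib

section
/- For every r>0 there is a constant C(r) such that for all real a≤−r², all ξ∈ℝ, all k∈ℝ and all t≥1, the improper oscillatory integral H = lim_{R→∞} ∫_k^R e^{−iξl} e^{it(12al+4l³)} dl exists, and |H| ≤ C(r)·t^{−1/2}·(1+|ξ|). -/
open MeasureTheory Filter
open scoped Real

/-- The oscillatory factor `exp (i (4 t l³ + β l))`. -/
noncomputable def cubicWave (t β l : ℝ) : ℂ :=
  Complex.exp (((4 * t * l ^ 3 + β * l : ℝ) : ℂ) * Complex.I)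

theorem norm_cubicWave (t β l : ℝ) : ‖cubicWave t β l‖ = 1 :=
  Complex.norm_exp_ofReal_mul_I _

theorem hasDerivAt_cubicWave (t β l : ℝ) :
    HasDerivAt (cubicWave t β)
      (cubicWave t β l * (((12 * t * l ^ 2 + β : ℝ) : ℂ) * Complex.I)) l := by
  have h : HasDerivAt (fun x : ℝ => 4 * t * x ^ 3 + β * x) (12 * t * l ^ 2 + β) l := by
    have h₁ := ((hasDerivAt_pow 3 l).const_mul (4 * t)).add ((hasDerivAt_id l).const_mul β)
    exact h₁.congr_deriv (by norm_num; ring)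
  exact (h.ofReal_comp.mul_const Complex.I).cexp

theorem continuous_cubicWave (t β : ℝ) : Continuous (cubicWave t β) :=
  continuous_iff_continuousAt.2 fun l => (hasDerivAt_cubicWave t β l).continuousAt

theorem intervalIntegrable_cubicWave (t β a b : ℝ) :
    IntervalIntegrable (cubicWave t β) volume a b :=
  (continuous_cubicWave t β).intervalIntegrable a b

theorem norm_integral_cubicWave_le_abs (t β a b : ℝ) :
    ‖∫ l in a..b, cubicWave t β l‖ ≤ |b - a| := by
  simpa using intervalIntegral.norm_integral_le_of_norm_le_const (a := a) (b := b)
    fun l _ => (norm_cubicWave t β l).le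

/-- First-derivative van der Corput estimate for the cubic phase on the positive half-line. -/
theorem norm_integral_cubicWave_le_div {t β a b lam : ℝ} (ht : 0 ≤ t) (ha : 0 ≤ a) (hab : a ≤ b)
    (hlam : 0 < lam) (h : ∀ l ∈ Set.Icc a b, lam ≤ |12 * t * l ^ 2 + β|) :
    ‖∫ l in a..b, cubicWave t β l‖ ≤ 4 / lam := by
  set p : ℝ → ℝ := fun l => 12 * t * l ^ 2 + β with hp
  have hp_cont : Continuous p := by fun_prop
  have hp_deriv (l : ℝ) : HasDerivAt p (24 * t * l) l := by
    have h₁ := ((hasDerivAt_pow 2 l).const_mul (12 * t)).add_const β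
    exact h₁.congr_deriv (by norm_num; ring)
  have hp_ne : ∀ l ∈ Set.uIcc a b, p l ≠ 0 := by
    intro l hl
    rw [Set.uIcc_of_le hab] at hl
    exact abs_pos.1 (hlam.trans_le (h l hl))
  have hinv : ∀ l ∈ Set.Icc a b, |(p l)⁻¹| ≤ 1 / lam := by
    intro l hl
    rw [abs_inv, ← one_div]
    exact one_div_le_one_div_of_le hlam (h l hl)
  have hq_deriv : ∀ l ∈ Set.uIcc a b,
      HasDerivAt (fun x => (p x)⁻¹) (-(24 * t * l) / p l ^ 2) l :=
    fun l hl => (hp_deriv l).fun_inv (hp_ne l hl)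
  have hq_cont : ContinuousOn (fun l => -(24 * t * l) / p l ^ 2) (Set.uIcc a b) :=
    ContinuousOn.div (by fun_prop) (by fun_prop) fun l hl => pow_ne_zero 2 (hp_ne l hl)
  have hq_int := hq_cont.intervalIntegrable (μ := volume)
  have hq := intervalIntegral.integral_eq_sub_of_hasDerivAt hq_deriv hq_int
  set g : ℝ → ℂ := fun l =>
    cubicWave t β l * (((-(24 * t * l) / p l ^ 2 : ℝ) : ℂ) * -Complex.I) with hg
  have hg_int : IntervalIntegrable g volume a b := by
    apply ContinuousOn.intervalIntegrable
    exact (continuous_cubicWave t β).continuousOn.mul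
      ((Complex.continuous_ofReal.comp_continuousOn hq_cont).mul continuousOn_const)
  have hG : ∀ l ∈ Set.uIcc a b,
      HasDerivAt (fun x => cubicWave t β x * ((((p x)⁻¹ : ℝ) : ℂ) * -Complex.I))
        (cubicWave t β l + g l) l := by
    intro l hl
    refine ((hasDerivAt_cubicWave t β l).fun_mul
      ((hq_deriv l hl).ofReal_comp.mul_const (-Complex.I))).congr_deriv ?_
    have hne : ((p l : ℝ) : ℂ) ≠ 0 := by exact_mod_cast hp_ne l hl
    have hpl : 12 * t * l ^ 2 + β = p l := rfl
    rw [hpl, Complex.ofReal_inv]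
    congr 1
    have : cubicWave t β l * (((p l : ℝ) : ℂ) * Complex.I) * (((p l : ℝ) : ℂ)⁻¹ * -Complex.I)
        = cubicWave t β l * (((p l : ℝ) : ℂ) * ((p l : ℝ) : ℂ)⁻¹) * -(Complex.I * Complex.I) := by
      ring
    rw [this, mul_inv_cancel₀ hne, Complex.I_mul_I]
    ring
  have hFTC := intervalIntegral.integral_eq_sub_of_hasDerivAt hG
    ((intervalIntegrable_cubicWave t β a b).add hg_int)
  rw [intervalIntegral.integral_add (intervalIntegrable_cubicWave t β a b) hg_int] at hFTC
  have hg_le : ‖∫ l in a..b, g l‖ ≤ ∫ l in a..b, -(-(24 * t * l) / p l ^ 2) := by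
    refine intervalIntegral.norm_integral_le_of_norm_le hab (ae_of_all _ fun l hl => ?_) hq_int.neg
    have hl0 : 0 ≤ l := ha.trans hl.1.le
    simp only [hg, norm_mul, norm_cubicWave, Complex.norm_real, norm_neg, Complex.norm_I, one_mul,
      mul_one, Real.norm_eq_abs, neg_div, neg_neg]
    rw [abs_of_nonneg (by positivity)]
  rw [intervalIntegral.integral_neg, hq] at hg_le
  have hnorm (l : ℝ) :
      ‖cubicWave t β l * ((((p l)⁻¹ : ℝ) : ℂ) * -Complex.I)‖ = |(p l)⁻¹| := by
    rw [norm_mul, norm_mul, norm_cubicWave, Complex.norm_real, norm_neg, Complex.norm_I,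
      one_mul, mul_one, Real.norm_eq_abs]
  have hia := hinv a (Set.left_mem_Icc.2 hab)
  have hib := hinv b (Set.right_mem_Icc.2 hab)
  calc ‖∫ l in a..b, cubicWave t β l‖
      = ‖cubicWave t β b * ((((p b)⁻¹ : ℝ) : ℂ) * -Complex.I)
          - cubicWave t β a * ((((p a)⁻¹ : ℝ) : ℂ) * -Complex.I) - ∫ l in a..b, g l‖ := by
        rw [← hFTC, add_sub_cancel_right]
    _ ≤ |(p b)⁻¹| + |(p a)⁻¹| + -((p b)⁻¹ - (p a)⁻¹) := by
        refine (norm_sub_le _ _).trans (add_le_add ((norm_sub_le _ _).trans ?_) hg_le)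
        rw [hnorm, hnorm]
    _ ≤ 1 / lam + 1 / lam + (1 / lam + 1 / lam) := by
        have := neg_abs_le (p b)⁻¹
        have := le_abs_self (p a)⁻¹
        linarith
    _ = 4 / lam := by ring

theorem exists_center_le_abs_quadratic {t δ : ℝ} (ht : 0 < t) (hδ : 0 ≤ δ) (β : ℝ) :
    ∃ c : ℝ, ∀ l, δ ≤ l → 12 * t * δ * |l - c| ≤ |12 * t * l ^ 2 + β| := by
  rcases le_total 0 β with hβ | hβ
  · refine ⟨0, fun l hl => ?_⟩
    have hl0 : 0 ≤ l := hδ.trans hl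
    rw [sub_zero, abs_of_nonneg hl0, abs_of_nonneg (by positivity)]
    have : t * (δ * l) ≤ t * (l * l) := by gcongr
    nlinarith
  · refine ⟨√(-β / (12 * t)), fun l hl => ?_⟩
    set c := √(-β / (12 * t)) with hc
    have hc0 : 0 ≤ c := Real.sqrt_nonneg _
    have hcsq : c ^ 2 = -β / (12 * t) :=
      Real.sq_sqrt (div_nonneg (neg_nonneg.2 hβ) (by positivity))
    have hfac : 12 * t * l ^ 2 + β = 12 * t * (l + c) * (l - c) := by
      have : 12 * t * c ^ 2 = -β := by rw [hcsq]; field_simp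
      linear_combination this
    have hlc : 0 ≤ l + c := by linarith
    rw [hfac, abs_mul (12 * t * (l + c)), abs_of_nonneg (by positivity : 0 ≤ 12 * t * (l + c))]
    gcongr
    linarith

/-- Second-derivative van der Corput estimate for the cubic phase away from its inflection point. -/
theorem norm_integral_cubicWave_le_div_sqrt {t δ a b : ℝ} (ht : 0 < t) (hδ : 0 < δ) (β : ℝ)
    (ha : δ ≤ a) (hab : a ≤ b) :
    ‖∫ l in a..b, cubicWave t β l‖ ≤ 3 / √(t * δ) := by
  obtain ⟨c, hc⟩ := exists_center_le_abs_quadratic ht hδ.le β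
  set s := √(t * δ) with hs
  have hs0 : 0 < s := Real.sqrt_pos.2 (mul_pos ht hδ)
  have hss : s ^ 2 = t * δ := Real.sq_sqrt (mul_pos ht hδ).le
  have hfar : ∀ u v, a ≤ u → u ≤ v → (∀ l ∈ Set.Icc u v, 1 / s ≤ |l - c|) →
      ‖∫ l in u..v, cubicWave t β l‖ ≤ 4 / (12 * s) := by
    intro u v hu huv h
    refine norm_integral_cubicWave_le_div ht.le (by linarith) huv (by positivity) fun l hl => ?_
    refine le_trans ?_ (hc l (by linarith [hl.1]))
    calc 12 * s = 12 * s ^ 2 * (1 / s) := by field_simp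
      _ = 12 * t * δ * (1 / s) := by rw [hss]; ring
      _ ≤ _ := by gcongr; exact h l hl
  set p := max a (min b (c - 1 / s)) with hp
  set q := max a (min b (c + 1 / s)) with hq
  have hinv : 0 < 1 / s := by positivity
  have hap : a ≤ p := le_max_left _ _
  have hpq : p ≤ q := by
    rw [hp, hq]; gcongr; linarith
  have hqb : q ≤ b := max_le hab (min_le_left _ _)
  have h₁ : ‖∫ l in a..p, cubicWave t β l‖ ≤ 4 / (12 * s) := by
    rcases le_total (min b (c - 1 / s)) a with h | h
    · rw [hp, max_eq_left h, intervalIntegral.integral_same, norm_zero]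
      positivity
    · refine hfar a p le_rfl hap fun l hl => ?_
      have : p ≤ c - 1 / s := by rw [hp, max_eq_right h]; exact min_le_right _ _
      rw [abs_sub_comm]
      exact le_trans (by linarith [hl.2]) (le_abs_self _)
  have h₂ : ‖∫ l in p..q, cubicWave t β l‖ ≤ 2 / s := by
    refine (norm_integral_cubicWave_le_abs t β p q).trans ?_
    rw [abs_of_nonneg (by linarith)]
    have h2 : 2 / s = 1 / s + 1 / s := by ring
    have : q ≤ p + 2 / s := by
      refine max_le (by linarith) ?_
      rcases le_total b (c - 1 / s) with h | h
      · have : b ≤ p := by rw [hp, min_eq_left h]; exact le_max_right _ _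
        linarith [min_le_left b (c + 1 / s)]
      · have : c - 1 / s ≤ p := by rw [hp, min_eq_right h]; exact le_max_right _ _
        linarith [min_le_right b (c + 1 / s)]
    linarith
  have h₃ : ‖∫ l in q..b, cubicWave t β l‖ ≤ 4 / (12 * s) := by
    rcases le_total b (c + 1 / s) with h | h
    · rw [hq, min_eq_left h, max_eq_right hab, intervalIntegral.integral_same, norm_zero]
      positivity
    · refine hfar q b (hap.trans hpq) hqb fun l hl => ?_
      have : c + 1 / s ≤ q := by rw [hq, min_eq_right h]; exact le_max_right _ _
      exact le_trans (by linarith [hl.1]) (le_abs_self _)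
  have hsplit : ∫ l in a..b, cubicWave t β l = (∫ l in a..p, cubicWave t β l)
      + (∫ l in p..q, cubicWave t β l) + ∫ l in q..b, cubicWave t β l := by
    rw [intervalIntegral.integral_add_adjacent_intervals,
      intervalIntegral.integral_add_adjacent_intervals] <;>
    exact intervalIntegrable_cubicWave _ _ _ _
  rw [hsplit]
  refine (norm_add₃_le).trans ((add_le_add (add_le_add h₁ h₂) h₃).trans ?_)
  have : 4 / (12 * s) + 2 / s + 4 / (12 * s) = (8 / 3) / s := by field_simp; norm_num
  rw [this]
  gcongr
  norm_num

theorem cubicWave_neg (t β l : ℝ) :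
    cubicWave t β (-l) = (starRingEnd ℂ) (cubicWave t β l) := by
  rw [cubicWave, cubicWave, ← Complex.exp_conj, map_mul, Complex.conj_ofReal, Complex.conj_I]
  congr 1
  push_cast
  ring

theorem norm_integral_cubicWave_neg (t β x : ℝ) :
    ‖∫ l in (0 : ℝ)..(-x), cubicWave t β l‖ = ‖∫ l in (0 : ℝ)..x, cubicWave t β l‖ := by
  have h := intervalIntegral.integral_comp_neg (a := 0) (b := x) (cubicWave t β)
  simp only [cubicWave_neg, neg_zero] at h
  rw [intervalIntegral.integral_symm, ← h, norm_neg, ← RCLike.norm_conj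
    (∫ l in (0 : ℝ)..x, cubicWave t β l), intervalIntegral, intervalIntegral]
  simp only [map_sub, ← integral_conj]

/-- A bound near the inflection point propagates to all bounded intervals. -/
theorem norm_integral_cubicWave_le {t δ K : ℝ} (ht : 0 < t) (hδ : 0 < δ) (β : ℝ)
    (hK : ∀ x, 0 ≤ x → x ≤ δ → ‖∫ l in (0 : ℝ)..x, cubicWave t β l‖ ≤ K) (a b : ℝ) :
    ‖∫ l in a..b, cubicWave t β l‖ ≤ 2 * (K + 3 / √(t * δ)) := by
  have hpos : ∀ x, 0 ≤ x → ‖∫ l in (0 : ℝ)..x, cubicWave t β l‖ ≤ K + 3 / √(t * δ) := by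
    intro x hx
    rcases le_total x δ with h | h
    · exact (hK x hx h).trans (le_add_of_nonneg_right (by positivity))
    · rw [← intervalIntegral.integral_add_adjacent_intervals
        (intervalIntegrable_cubicWave t β 0 δ) (intervalIntegrable_cubicWave t β δ x)]
      exact (norm_add_le _ _).trans (add_le_add (hK δ hδ.le le_rfl)
        (norm_integral_cubicWave_le_div_sqrt ht hδ β le_rfl h))
  have hall (x : ℝ) : ‖∫ l in (0 : ℝ)..x, cubicWave t β l‖ ≤ K + 3 / √(t * δ) := by
    rcases le_total 0 x with h | h
    · exact hpos x h
    · rw [← norm_integral_cubicWave_neg]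
      exact hpos (-x) (neg_nonneg.2 h)
  rw [← intervalIntegral.integral_interval_sub_left
    (intervalIntegrable_cubicWave t β 0 b) (intervalIntegrable_cubicWave t β 0 a)]
  exact (norm_sub_le _ _).trans (by linarith [hall a, hall b])

theorem exists_tendsto_integral_cubicWave {t : ℝ} (ht : 0 < t) (β k : ℝ) :
    ∃ H : ℂ, Tendsto (fun R => ∫ l in k..R, cubicWave t β l) atTop (nhds H) := by
  refine cauchy_map_iff_exists_tendsto.1 ?_
  rw [Metric.cauchy_iff]
  refine ⟨inferInstance, fun ε hε => ?_⟩
  have hlim : Tendsto (fun l : ℝ => 12 * t * l ^ 2 + β) atTop atTop :=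
    tendsto_atTop_add_const_right _ _
      ((tendsto_pow_atTop two_ne_zero).const_mul_atTop (by positivity))
  obtain ⟨N, hN⟩ := eventually_atTop.1
    ((hlim.eventually_ge_atTop (8 / ε)).and (eventually_ge_atTop 0))
  have hmain : ∀ x y, N ≤ x → x ≤ y →
      dist (∫ l in k..y, cubicWave t β l) (∫ l in k..x, cubicWave t β l) < ε := by
    intro x y hx hxy
    rw [dist_eq_norm, intervalIntegral.integral_interval_sub_left
      (intervalIntegrable_cubicWave t β k y) (intervalIntegrable_cubicWave t β k x)]
    refine (norm_integral_cubicWave_le_div ht.le (hN x hx).2 hxy (by positivity : 0 < 8 / ε)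
      fun l hl => (hN l (hx.trans hl.1)).1.trans (le_abs_self _)).trans_lt ?_
    rw [div_div_eq_mul_div]
    linarith
  refine ⟨_, image_mem_map (Ici_mem_atTop N), ?_⟩
  rintro _ ⟨x, hx, rfl⟩ _ ⟨y, hy, rfl⟩
  rcases le_total x y with h | h
  · rw [dist_comm]
    exact hmain x y hx h
  · exact hmain y x hy h

/-- Lemma `lemma:partial.airy.ndg`.  For every `r > 0` there
is `C(r)` such that for all `a ≤ −r²`, all `ξ, k ∈ ℝ` and `t ≥ 1`, the improper
oscillatory integral `H = lim_{R→∞} ∫_k^R e^{−iξl} e^{it(12al+4l³)} dl` exists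
and `|H| ≤ C(r) t^{-1/2} (1+|ξ|)`. -/
theorem statement17 (r : ℝ) (hr : 0 < r) :
    ∃ C : ℝ, ∀ a ξ k t : ℝ, a ≤ -r ^ 2 → 1 ≤ t →
      ∃ H : ℂ,
        Tendsto (fun R : ℝ =>
            ∫ l in Set.Ioc k R,
              Complex.exp (-(Complex.I * (ξ : ℂ) * (l : ℂ))) *
                Complex.exp (Complex.I * (t : ℂ) * ((12 * a * l + 4 * l ^ 3 : ℝ) : ℂ)))
          atTop (nhds H) ∧
        ‖H‖ ≤ C * t ^ (-(1 : ℝ) / 2) * (1 + |ξ|) := by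
  refine ⟨2 / r ^ 2 + 2 * (4 / (3 * r ^ 2) + 3 / √(r / 2)), fun a ξ k t ha ht => ?_⟩
  have ht0 : 0 < t := by linarith
  obtain ⟨H, hH⟩ := exists_tendsto_integral_cubicWave ht0 (12 * t * a - ξ) k
  refine ⟨H, hH.congr' ?_, ?_⟩
  · filter_upwards [eventually_ge_atTop k] with R hR
    rw [intervalIntegral.integral_of_le hR]
    refine integral_congr_ae (ae_of_all _ fun l => ?_)
    simp only [cubicWave]
    rw [← Complex.exp_add]
    congr 1
    push_cast
    ring
  set s := √t with hs
  have hs1 : 1 ≤ s := Real.one_le_sqrt.2 ht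
  have hs0 : 0 < s := by linarith
  have hss : s ^ 2 = t := Real.sq_sqrt ht0.le
  have hpow : t ^ (-(1 : ℝ) / 2) = 1 / s := by
    rw [neg_div, Real.rpow_neg ht0.le, ← Real.sqrt_eq_rpow, one_div]
  rw [hpow]
  have hbound : ∀ B, (∀ R, ‖∫ l in k..R, cubicWave t (12 * t * a - ξ) l‖ ≤ B) → ‖H‖ ≤ B :=
    fun B hB => le_of_tendsto hH.norm (Eventually.of_forall hB)
  have hM : 0 ≤ 2 * (4 / (3 * r ^ 2) + 3 / √(r / 2)) := by positivity
  rcases le_total (6 * t * r ^ 2) |ξ| with hξ | hξ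
  · have hH8 : ‖H‖ ≤ 8 := by
      refine (hbound _ fun R => norm_integral_cubicWave_le ht0 one_pos _ (K := 1) ?_ k R).trans ?_
      · intro x hx hx1
        refine (norm_integral_cubicWave_le_abs _ _ _ _).trans ?_
        rwa [sub_zero, abs_of_nonneg hx]
      · rw [mul_one]
        have : 3 / √t ≤ 3 := div_le_self (by norm_num) hs1
        linarith
    calc ‖H‖ ≤ 8 := hH8
      _ ≤ 12 * s := by linarith
      _ = 2 / r ^ 2 * (1 / s) * (6 * t * r ^ 2) := by
        rw [← hss]; field_simp; norm_num
      _ ≤ (2 / r ^ 2 + 2 * (4 / (3 * r ^ 2) + 3 / √(r / 2))) * (1 / s) * (1 + |ξ|) := by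
        gcongr <;> linarith
  · have hβ : 12 * t * a - ξ ≤ -(6 * t * r ^ 2) := by
      have := neg_abs_le ξ
      have : t * a ≤ t * (-r ^ 2) := by gcongr
      linarith
    have hr2 : 0 < r / 2 := by positivity
    refine (hbound _ fun R => norm_integral_cubicWave_le ht0 hr2 _
      (K := 4 / (3 * t * r ^ 2)) ?_ k R).trans ?_
    · intro x hx hxr
      refine norm_integral_cubicWave_le_div ht0.le le_rfl hx (by positivity) fun l hl => ?_
      have hl2 : l ^ 2 ≤ (r / 2) ^ 2 := pow_le_pow_left₀ hl.1 (hl.2.trans hxr) 2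
      have : t * l ^ 2 ≤ t * (r / 2) ^ 2 := by gcongr
      refine le_trans ?_ (neg_le_abs _)
      linarith
    · rw [Real.sqrt_mul ht0.le, ← hs]
      have h₁ : 4 / (3 * t * r ^ 2) ≤ 4 / (3 * r ^ 2) * (1 / s) := by
        rw [div_mul_div_comm, mul_one]
        refine div_le_div_of_nonneg_left (by norm_num) (by positivity) ?_
        have : r ^ 2 * s ≤ r ^ 2 * s ^ 2 := by gcongr; exact le_self_pow₀ hs1 two_ne_zero
        rw [← hss]
        linarith
      have h₂ : 3 / (s * √(r / 2)) = 3 / √(r / 2) * (1 / s) := by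
        rw [div_mul_div_comm, mul_one, mul_comm]
      calc 2 * (4 / (3 * t * r ^ 2) + 3 / (s * √(r / 2)))
          ≤ (0 + 2 * (4 / (3 * r ^ 2) + 3 / √(r / 2))) * (1 / s) * 1 := by
            rw [h₂]; linarith
        _ ≤ (2 / r ^ 2 + 2 * (4 / (3 * r ^ 2) + 3 / √(r / 2))) * (1 / s) * (1 + |ξ|) := by
            gcongr
            · positivity
            · linarith [abs_nonneg ξ]
end

section
/- There is an absolute constant C such that for all real m and b, the improper Airy-type integral I(m,b) = lim_{R→∞} ∫_m^R e^{i(s³/3+bs)} ds exists and satisfies |I(m,b)| ≤ C. -/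
open MeasureTheory Filter

/-- The oscillating Airy integrand `e^{i(s³/3+bs)}`. -/
noncomputable def airyIntegrand (b s : ℝ) : ℂ :=
  Complex.exp (Complex.I * ((s ^ 3 / 3 + b * s : ℝ) : ℂ))

lemma continuous_airyIntegrand (b : ℝ) : Continuous (airyIntegrand b) := by
  unfold airyIntegrand
  fun_prop

lemma intervalIntegrable_airyIntegrand (b p q : ℝ) :
    IntervalIntegrable (airyIntegrand b) volume p q :=
  (continuous_airyIntegrand b).intervalIntegrable _ _

lemma norm_airyIntegrand (b s : ℝ) : ‖airyIntegrand b s‖ = 1 := by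
  rw [airyIntegrand, mul_comm]
  exact Complex.norm_exp_ofReal_mul_I _

lemma airyIntegrand_neg (b s : ℝ) :
    airyIntegrand b (-s) = starRingEnd ℂ (airyIntegrand b s) := by
  simp only [airyIntegrand, ← Complex.exp_conj, map_mul, Complex.conj_I, Complex.conj_ofReal]
  congr 1
  push_cast
  ring

lemma hasDerivAt_airyIntegrand (b s : ℝ) :
    HasDerivAt (airyIntegrand b)
      (airyIntegrand b s * (Complex.I * ((s ^ 2 + b : ℝ) : ℂ))) s := by
  have hphase : HasDerivAt (fun s : ℝ => s ^ 3 / 3 + b * s) (s ^ 2 + b) s := by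
    refine (((hasDerivAt_pow 3 s).div_const 3).add
      ((hasDerivAt_id s).const_mul b)).congr_deriv ?_
    simp
  exact (hphase.ofReal_comp.const_mul Complex.I).cexp

lemma hasDerivAt_inv_sq_add {b s : ℝ} (hs : s ^ 2 + b ≠ 0) :
    HasDerivAt (fun s : ℝ => (s ^ 2 + b)⁻¹) (-(2 * s) / (s ^ 2 + b) ^ 2) s := by
  have h : HasDerivAt (fun s : ℝ => s ^ 2 + b) (2 * s) s := by
    simpa using (hasDerivAt_pow 2 s).add_const b
  exact h.fun_inv hs

/-- First-derivative van der Corput estimate on the half-line where `s² + b` is increasing. -/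
lemma norm_integral_airyIntegrand_le {b p q l : ℝ} (hp : 0 ≤ p) (hpq : p ≤ q) (hl : 0 < l)
    (h : ∀ s ∈ Set.Icc p q, l ≤ |s ^ 2 + b|) :
    ‖∫ s in p..q, airyIntegrand b s‖ ≤ 4 / l := by
  have hne : ∀ s ∈ Set.Icc p q, s ^ 2 + b ≠ 0 := fun s hs =>
    abs_pos.mp (hl.trans_le (h s hs))
  have hinv : ∀ s ∈ Set.Icc p q, |(s ^ 2 + b)⁻¹| ≤ 1 / l := fun s hs => by
    rw [abs_inv, ← one_div]
    exact one_div_le_one_div_of_le hl (h s hs)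
  have hpI : p ∈ Set.Icc p q := ⟨le_rfl, hpq⟩
  have hqI : q ∈ Set.Icc p q := ⟨hpq, le_rfl⟩
  set w : ℝ → ℝ := fun s => 2 * s / (s ^ 2 + b) ^ 2 with hw
  have hwc : ContinuousOn w (Set.uIcc p q) := by
    rw [Set.uIcc_of_le hpq]
    exact ContinuousOn.div (by fun_prop) (by fun_prop) fun s hs => pow_ne_zero 2 (hne s hs)
  have hwint : ∫ s in p..q, w s = (p ^ 2 + b)⁻¹ - (q ^ 2 + b)⁻¹ := by
    have := intervalIntegral.integral_eq_sub_of_hasDerivAt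
      (f := fun s => -(s ^ 2 + b)⁻¹) (f' := w) (a := p) (b := q) (fun s hs => by
        rw [Set.uIcc_of_le hpq] at hs
        refine (hasDerivAt_inv_sq_add (hne s hs)).neg.congr_deriv ?_
        simp only [hw]
        ring) hwc.intervalIntegrable
    rw [this]
    ring
  set E : ℝ → ℂ := fun s => Complex.I * airyIntegrand b s * (w s : ℂ) with hE
  have hEc : ContinuousOn E (Set.uIcc p q) :=
    (continuous_const.mul (continuous_airyIntegrand b)).continuousOn.mul
      (Complex.continuous_ofReal.comp_continuousOn hwc)
  set G : ℝ → ℂ := fun s => -Complex.I * airyIntegrand b s * (((s ^ 2 + b)⁻¹ : ℝ) : ℂ) with hG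
  have hparts : ∫ s in p..q, (airyIntegrand b s + E s) = G q - G p := by
    refine intervalIntegral.integral_eq_sub_of_hasDerivAt (fun s hs => ?_)
      ((intervalIntegrable_airyIntegrand b p q).add hEc.intervalIntegrable)
    rw [Set.uIcc_of_le hpq] at hs
    refine (((hasDerivAt_airyIntegrand b s).const_mul (-Complex.I)).mul
      (hasDerivAt_inv_sq_add (hne s hs)).ofReal_comp).congr_deriv ?_
    have hc : ((s ^ 2 + b : ℝ) : ℂ) ≠ 0 := Complex.ofReal_ne_zero.mpr (hne s hs)
    simp only [hE, hw, Complex.ofReal_div, Complex.ofReal_inv, Complex.ofReal_neg,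
      Complex.ofReal_pow (s ^ 2 + b)]
    field_simp
    linear_combination (-airyIntegrand b s * ((s ^ 2 + b : ℝ) : ℂ) ^ 2) * Complex.I_sq
  have hGle : ∀ s ∈ Set.Icc p q, ‖G s‖ ≤ 1 / l := fun s hs => by
    simpa only [hG, norm_mul, norm_neg, Complex.norm_I, norm_airyIntegrand, one_mul,
      Complex.norm_real, Real.norm_eq_abs] using hinv s hs
  have hEle : ‖∫ s in p..q, E s‖ ≤ (p ^ 2 + b)⁻¹ - (q ^ 2 + b)⁻¹ := by
    rw [← hwint]
    refine intervalIntegral.norm_integral_le_of_norm_le hpq (ae_of_all _ fun s hs => ?_)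
      hwc.intervalIntegrable
    have hs0 : 0 ≤ s := hp.trans hs.1.le
    have hw0 : 0 ≤ w s := by simp only [hw]; positivity
    simp only [hE, norm_mul, Complex.norm_I, norm_airyIntegrand, one_mul, Complex.norm_real,
      Real.norm_eq_abs, abs_of_nonneg hw0, le_refl]
  rw [intervalIntegral.integral_add (intervalIntegrable_airyIntegrand b p q)
    hEc.intervalIntegrable] at hparts
  have hsplit : ∫ s in p..q, airyIntegrand b s = G q - G p - ∫ s in p..q, E s :=
    eq_sub_of_add_eq hparts
  have hp' := le_of_abs_le (hinv p hpI)
  have hq' := neg_le_of_abs_le (hinv q hqI)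
  calc ‖∫ s in p..q, airyIntegrand b s‖ ≤ ‖G q‖ + ‖G p‖ + ‖∫ s in p..q, E s‖ := by
        rw [hsplit]
        exact (norm_sub_le _ _).trans (by gcongr; exact norm_sub_le _ _)
    _ ≤ 1 / l + 1 / l + (1 / l + 1 / l) := by
        have := hGle p hpI
        have := hGle q hqI
        linarith
    _ = 4 / l := by ring

lemma norm_integral_airyIntegrand_le_length {b p q : ℝ} (hpq : p ≤ q) :
    ‖∫ s in p..q, airyIntegrand b s‖ ≤ q - p := by
  have := intervalIntegral.norm_integral_le_of_norm_le_const (f := airyIntegrand b)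
    (a := p) (b := q) (C := 1) fun s _ => (norm_airyIntegrand b s).le
  rwa [one_mul, abs_of_nonneg (sub_nonneg.mpr hpq)] at this

lemma norm_integral_zero_airyIntegrand_le_of_nonneg (b : ℝ) {x : ℝ} (hx : 0 ≤ x) :
    ‖∫ s in (0 : ℝ)..x, airyIntegrand b s‖ ≤ 10 := by
  set a := √(-b - 1) with ha
  set c := √(1 - b) with hc
  have ha0 : 0 ≤ a := Real.sqrt_nonneg _
  have hac : a ≤ c := Real.sqrt_le_sqrt (by linarith)
  have hca : c ≤ a + 2 := by
    refine Real.sqrt_le_iff.mpr ⟨by linarith, ?_⟩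
    rcases le_total 0 (-b - 1) with hb | hb
    · have := Real.sq_sqrt hb
      nlinarith
    · nlinarith
  have hii := intervalIntegrable_airyIntegrand b
  set y := min x a with hy
  set z := min x c with hz
  have hy0 : 0 ≤ y := le_min hx ha0
  have hyz : y ≤ z := min_le_min le_rfl hac
  have hzx : z ≤ x := min_le_left _ _
  have hleft : ‖∫ s in (0 : ℝ)..y, airyIntegrand b s‖ ≤ 4 / 1 := by
    rcases le_total (-b - 1) 0 with hb | hb
    · have hy' : y = 0 := le_antisymm
        ((min_le_right _ _).trans (Real.sqrt_eq_zero_of_nonpos hb).le) hy0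
      simp [hy']
    · refine norm_integral_airyIntegrand_le le_rfl hy0 one_pos fun s hs => le_abs.mpr (Or.inr ?_)
      have hsa : s ≤ a := hs.2.trans (min_le_right _ _)
      have := Real.sq_sqrt hb
      have := pow_le_pow_left₀ hs.1 hsa 2
      linarith
  have hmid : ‖∫ s in y..z, airyIntegrand b s‖ ≤ 2 := by
    refine (norm_integral_airyIntegrand_le_length hyz).trans ?_
    rcases le_total x a with h | h
    · rw [hy, hz, min_eq_left h, min_eq_left (h.trans hac)]
      norm_num
    · rw [hy, min_eq_right h]
      linarith [min_le_right x c]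
  have hright : ‖∫ s in z..x, airyIntegrand b s‖ ≤ 4 / 1 := by
    rcases le_total x c with h | h
    · simp [hz, min_eq_left h]
    · rw [hz, min_eq_right h]
      refine norm_integral_airyIntegrand_le (ha0.trans hac) h one_pos
        fun s hs => le_abs.mpr (Or.inl ?_)
      have := (Real.sqrt_le_left (ha0.trans (hac.trans hs.1))).mp hs.1
      linarith
  rw [← intervalIntegral.integral_add_adjacent_intervals (hii 0 y) (hii y x),
    ← intervalIntegral.integral_add_adjacent_intervals (hii y z) (hii z x)]
  calc _ ≤ _ := (norm_add_le _ _).trans (add_le_add_right (norm_add_le _ _) _)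
    _ ≤ 10 := by linarith

lemma norm_integral_zero_airyIntegrand_le (b x : ℝ) :
    ‖∫ s in (0 : ℝ)..x, airyIntegrand b s‖ ≤ 10 := by
  rcases le_total 0 x with hx | hx
  · exact norm_integral_zero_airyIntegrand_le_of_nonneg b hx
  · have h := norm_integral_zero_airyIntegrand_le_of_nonneg b (neg_nonneg.mpr hx)
    have hconj : ∫ s in (0 : ℝ)..(-x), airyIntegrand b s =
        starRingEnd ℂ (∫ s in x..0, airyIntegrand b s) := by
      rw [← intervalIntegral.intervalIntegral_conj]
      simp_rw [← airyIntegrand_neg]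
      simp
    rwa [hconj, RCLike.norm_conj, intervalIntegral.integral_symm, norm_neg] at h

lemma exists_tendsto_integral_zero_airyIntegrand (b : ℝ) :
    ∃ L : ℂ, Tendsto (fun R : ℝ => ∫ s in (0 : ℝ)..R, airyIntegrand b s) atTop (nhds L) := by
  refine cauchySeq_tendsto_of_complete (Metric.cauchySeq_iff'.mpr fun ε hε => ?_)
  have hl : 0 < 8 / ε := by positivity
  have hmono : Tendsto (fun s : ℝ => s ^ 2 + b) atTop atTop :=
    tendsto_atTop_add_const_right _ _ (tendsto_pow_atTop two_ne_zero)
  obtain ⟨N, hN⟩ := eventually_atTop.mp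
    ((hmono.eventually_ge_atTop (8 / ε)).and (eventually_ge_atTop 0))
  refine ⟨N, fun R hR => ?_⟩
  rw [dist_eq_norm, intervalIntegral.integral_interval_sub_left
    (intervalIntegrable_airyIntegrand b 0 R) (intervalIntegrable_airyIntegrand b 0 N)]
  calc _ ≤ 4 / (8 / ε) := norm_integral_airyIntegrand_le (hN N le_rfl).2 hR hl
          fun s hs => (hN s hs.1).1.trans (le_abs_self _)
    _ < ε := by
        field_simp
        linarith

/-- There is an absolute constant `C` such that for all real
`m` and `b` the improper Airy-type integral
`I(m,b) = lim_{R→∞} ∫_m^R e^{i(s³/3+bs)} ds` exists and `|I(m,b)| ≤ C`. -/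
theorem statement19 :
    ∃ C : ℝ, ∀ m b : ℝ,
      ∃ I : ℂ,
        Tendsto (fun R : ℝ =>
            ∫ s in Set.Ioc m R,
              Complex.exp (Complex.I * ((s ^ 3 / 3 + b * s : ℝ) : ℂ)))
          atTop (nhds I) ∧
        ‖I‖ ≤ C := by
  refine ⟨20, fun m b => ?_⟩
  obtain ⟨L, hL⟩ := exists_tendsto_integral_zero_airyIntegrand b
  refine ⟨L - ∫ s in (0 : ℝ)..m, airyIntegrand b s, ?_, ?_⟩
  · refine (hL.sub_const _).congr' ?_
    filter_upwards [eventually_ge_atTop m] with R hR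
    rw [intervalIntegral.integral_interval_sub_left (intervalIntegrable_airyIntegrand b 0 R)
      (intervalIntegrable_airyIntegrand b 0 m), intervalIntegral.integral_of_le hR]
    rfl
  · have hLle : ‖L‖ ≤ 10 :=
      le_of_tendsto hL.norm (Eventually.of_forall (norm_integral_zero_airyIntegrand_le b))
    linarith [norm_sub_le L (∫ s in (0 : ℝ)..m, airyIntegrand b s),
      norm_integral_zero_airyIntegrand_le b m]
end
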